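/- arXiv:2009.09793 — 4 statements merged into one kernel-verified Lean document; each statement's English description precedes it below -/
import Mathlib

section
/- Let $D$ be a division ring, $f(x) \in D[x]$ a standard polynomial, $\lambda \in D$, and $n \geq 1$ a natural number. If $\lambda$ commutes with $f^{\circ t}(\lambda)$ (the evaluation of the $t$-fold composition of $f$ with itself at $\lambda$) for every $t$ with $1 \leq t < n$, then $f^{\circ n}(\lambda) = f^{* n}(\lambda)$, i.e., the evaluation at $\lambda$ of the $n$-fold composition of $f$ equals the $n$-fold iterate of the evaluation map $\mu \mapsto f(\mu)$ applied to $\lambda$. -/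
/-- `ocomp f n` is the `n`-fold self-composition `f^{∘n}` of the standard polynomial `f`,
defined by `f^{∘0} = x`, `f^{∘(n+1)} = f(f^{∘n}(x))` (so `f^{∘1} = f`). -/
noncomputable def ocomp {D : Type*} [DivisionRing D] (f : Polynomial D) : ℕ → Polynomial D
  | 0 => Polynomial.X
  | n + 1 => f.comp (ocomp f n)

/-- Evaluation at `x` is multiplicative on `p * q` as soon as `x` commutes with `q(x)`. -/
theorem eval_mul_of_commute_eval {R : Type*} [Ring R] (p q : Polynomial R) {x : R}
    (hx : Commute x (q.eval x)) : (p * q).eval x = p.eval x * q.eval x := by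
  induction p using Polynomial.induction_on' with
  | add p₁ p₂ h₁ h₂ => simp only [add_mul, Polynomial.eval_add, h₁, h₂]
  | monomial n a =>
    rw [← Polynomial.C_mul_X_pow_eq_monomial, mul_assoc, Polynomial.X_pow_mul,
      Polynomial.eval_C_mul, Polynomial.eval_mul_X_pow, Polynomial.eval_C_mul,
      ← one_mul (Polynomial.X ^ n), Polynomial.eval_mul_X_pow, Polynomial.eval_one, one_mul,
      mul_assoc, (hx.pow_left n).eq]

theorem eval_pow_of_commute_eval {R : Type*} [Ring R] (q : Polynomial R) {x : R}
    (hx : Commute x (q.eval x)) (n : ℕ) : (q ^ n).eval x = q.eval x ^ n := by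
  induction n with
  | zero => simp
  | succ n ih => rw [pow_succ, eval_mul_of_commute_eval _ _ hx, ih, pow_succ]

theorem eval_comp_of_commute_eval {R : Type*} [Ring R] (p q : Polynomial R) {x : R}
    (hx : Commute x (q.eval x)) : (p.comp q).eval x = p.eval (q.eval x) := by
  rw [Polynomial.comp, Polynomial.eval₂_eq_sum_range, Polynomial.eval_finsetSum,
    Polynomial.eval_eq_sum_range]
  simp only [Polynomial.eval_C_mul, eval_pow_of_commute_eval q hx]

/-- Let `D` be a division ring, `f ∈ D[x]`, `λ ∈ D` and `n ≥ 1`.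
If `λ` commutes with `f^{∘t}(λ)` for all `1 ≤ t < n`, then the evaluation at `λ` of the
`n`-fold composition equals the `n`-fold iterate of the evaluation map applied to `λ`:
`f^{∘n}(λ) = f^{*n}(λ)`. -/
theorem eval_ocomp_eq_iterate_of_commute_ocomp {D : Type*} [DivisionRing D]
    (f : Polynomial D) (lam : D) (n : ℕ) (hn : 1 ≤ n)
    (h : ∀ t : ℕ, 1 ≤ t → t < n → Commute lam ((ocomp f t).eval lam)) :
    (ocomp f n).eval lam = (fun mu : D => f.eval mu)^[n] lam := by
  induction n, hn using Nat.le_induction with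
  | base => simp [ocomp]
  | succ n hn ih =>
    rw [Function.iterate_succ_apply', ← ih fun t h₁ h₂ => h t h₁ (h₂.trans n.lt_succ_self)]
    exact eval_comp_of_commute_eval f _ (h n hn n.lt_succ_self)
end

section
/- Let $D$ be a division ring, $f(x) \in D[x]$ a standard polynomial, $\lambda \in D$, and $r \geq 1$ a natural number such that $f^{\circ r}(\lambda) = \lambda$ and $\lambda$ commutes with $f^{\circ t}(\lambda)$ for every $t$ with $1 \leq t < r$. Then $\lambda$ is an $r$-periodic point of $f(x)$, i.e., $f^{\circ (n r)}(\lambda) = \lambda$ for every $n \geq 1$, and moreover $\lambda$ commutes with its entire orbit, i.e., $\lambda$ commutes with $f^{\circ t}(\lambda)$ for every $t \geq 1$. -/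
namespace Polynomial

variable {R : Type*} [Semiring R]

/-- Evaluation at `x` is multiplicative when the value of the right factor commutes with `x`. -/
theorem eval_mul_of_commute_eval {x : R} {q : R[X]} (h : Commute x (q.eval x)) (p : R[X]) :
    (p * q).eval x = p.eval x * q.eval x := by
  induction p using Polynomial.induction_on' with
  | add p₁ p₂ h₁ h₂ => rw [add_mul, eval_add, h₁, h₂, eval_add, add_mul]
  | monomial n a =>
    rw [← C_mul_X_pow_eq_monomial, mul_assoc, eval_C_mul, X_pow_mul, eval_mul_X_pow, eval_C_mul,
      eval_X_pow, mul_assoc, (h.pow_left n).eq]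

theorem eval_pow_of_commute_eval {x : R} {q : R[X]} (h : Commute x (q.eval x)) (n : ℕ) :
    (q ^ n).eval x = q.eval x ^ n := by
  induction n with
  | zero => simp
  | succ n ih => rw [pow_succ, eval_mul_of_commute_eval h, ih, pow_succ]

theorem eval_comp_of_commute_eval {x : R} {q : R[X]} (h : Commute x (q.eval x)) (p : R[X]) :
    (p.comp q).eval x = p.eval (q.eval x) := by
  induction p using Polynomial.induction_on' with
  | add p₁ p₂ h₁ h₂ => rw [add_comp, eval_add, h₁, h₂, eval_add]
  | monomial n a => rw [monomial_comp, eval_C_mul, eval_pow_of_commute_eval h, eval_monomial]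

end Polynomial

/-- As long as the earlier values commute with `x`, evaluating the iterated composition at `x`
amounts to iterating the evaluation map. -/
theorem eval_ocomp_eq_iterate {D : Type*} [DivisionRing D] (f : Polynomial D) (x : D) (n : ℕ)
    (h : ∀ t < n, Commute x ((ocomp f t).eval x)) :
    (ocomp f n).eval x = (fun y => f.eval y)^[n] x := by
  induction n with
  | zero => simp [ocomp]
  | succ n ih =>
    rw [ocomp, Polynomial.eval_comp_of_commute_eval (h n n.lt_succ_self),
      ih fun t ht => h t (ht.trans n.lt_succ_self), Function.iterate_succ_apply']

/-- Let `D` be a division ring, `f ∈ D[x]`, `λ ∈ D`, and `r ≥ 1` with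
`f^{∘r}(λ) = λ` and `λ` commuting with `f^{∘t}(λ)` for all `1 ≤ t < r`. Then `λ` is an
`r`-periodic point of `f` (`f^{∘(nr)}(λ) = λ` for all `n ≥ 1`), and `λ` commutes with
its entire orbit (`λ` commutes with `f^{∘t}(λ)` for all `t ≥ 1`). -/
theorem periodic_of_ocomp_eval_eq_of_commute_ocomp {D : Type*} [DivisionRing D]
    (f : Polynomial D) (lam : D) (r : ℕ) (hr : 1 ≤ r)
    (hfix : (ocomp f r).eval lam = lam)
    (h : ∀ t : ℕ, 1 ≤ t → t < r → Commute lam ((ocomp f t).eval lam)) :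
    (∀ n : ℕ, 1 ≤ n → (ocomp f (n * r)).eval lam = lam) ∧
      (∀ t : ℕ, 1 ≤ t → Commute lam ((ocomp f t).eval lam)) := by
  have hlt : ∀ t < r, Commute lam ((ocomp f t).eval lam) := by
    intro t ht
    rcases t.eq_zero_or_pos with rfl | hpos
    · simp [ocomp]
    · exact h t hpos ht
  have hper : Function.IsPeriodicPt (fun y => f.eval y) r lam :=
    (eval_ocomp_eq_iterate f lam r hlt).symm.trans hfix
  have hiter : ∀ t, Commute lam ((fun y => f.eval y)^[t] lam) := by
    intro t
    have hmod : t % r < r := Nat.mod_lt t hr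
    rw [← hper.iterate_mod_apply t,
      ← eval_ocomp_eq_iterate f lam (t % r) fun s hs => hlt s (hs.trans hmod)]
    exact hlt _ hmod
  have heval : ∀ t, (ocomp f t).eval lam = (fun y => f.eval y)^[t] lam := by
    intro t
    induction t using Nat.strong_induction_on with
    | _ t ih =>
      exact eval_ocomp_eq_iterate f lam t fun s hs => by
        rw [ih s hs]
        exact hiter s
  refine ⟨fun n _ => ?_, fun t _ => ?_⟩
  · rw [heval]
    exact hper.const_mul n
  · rw [heval]
    exact hiter t
end

section
/- Let $D$ be a division ring and $f(x) \in D[x]$ a standard polynomial of degree $m \geq 2$. Then the fixed points of $f(x)$ belong to at most $m$ conjugacy classes of $D$: there exists a finite set $S \subseteq D$ with $|S| \leq m$ such that every $\lambda \in D$ with $f(\lambda) = \lambda$ is conjugate to some element of $S$ (i.e., there are $s \in S$ and a nonzero $u \in D$ with $\lambda = u s u^{-1}$). -/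
open Polynomial in
/-- Right division with remainder by `X - C a` over a possibly noncommutative ring. -/
theorem exists_eq_mul_X_sub_C_add_C_eval {R : Type*} [Ring R] (f : R[X]) (a : R) :
    ∃ q : R[X], f = q * (X - C a) + C (f.eval a) := by
  induction f using Polynomial.induction_on' with
  | add f g hf hg =>
    obtain ⟨p, hp⟩ := hf
    obtain ⟨q, hq⟩ := hg
    refine ⟨p + q, ?_⟩
    rw [eval_add, C_add, add_mul]
    nth_rewrite 1 [hp, hq]
    abel
  | monomial n c =>
    refine ⟨C c * ∑ i ∈ Finset.range n, X ^ i * C a ^ (n - 1 - i), ?_⟩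
    rw [mul_assoc, (commute_X (C a)).geom_sum₂_mul, eval_monomial, mul_sub, C_mul, C_pow,
      C_mul_X_pow_eq_monomial]
    abel

open Polynomial in
/-- The product formula for evaluation at `b` of a polynomial with right factor `X - C a`. -/
theorem eval_mul_X_sub_C_of_ne {D : Type*} [DivisionRing D] (q : D[X]) {a b : D} (h : b ≠ a) :
    (q * (X - C a)).eval b = q.eval ((b - a) * b * (b - a)⁻¹) * (b - a) := by
  have hba : b - a ≠ 0 := sub_ne_zero.mpr h
  have hpow (n : ℕ) : ((b - a) * b * (b - a)⁻¹) ^ n = (b - a) * b ^ n * (b - a)⁻¹ :=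
    Units.conj_pow (Units.mk0 _ hba) b n
  induction q using Polynomial.induction_on' with
  | add p q hp hq => rw [add_mul, eval_add, hp, hq, eval_add, add_mul]
  | monomial n c =>
    rw [mul_sub, monomial_mul_X, monomial_mul_C, eval_sub, eval_monomial, eval_monomial,
      eval_monomial, hpow, pow_succ', mul_assoc c _ (b - a), inv_mul_cancel_right₀ hba, sub_mul,
      mul_sub, mul_assoc c a]

open Polynomial in
/-- **Gordon–Motzkin theorem**: the roots of a nonzero polynomial over a division ring lie in at
most as many conjugacy classes as its degree. -/
theorem exists_finset_card_le_natDegree_isRoot_conj {D : Type*} [DivisionRing D] (g : D[X])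
    (hg : g ≠ 0) :
    ∃ S : Finset D, S.card ≤ g.natDegree ∧
      ∀ b : D, g.eval b = 0 → ∃ s ∈ S, ∃ u : D, u ≠ 0 ∧ b = u * s * u⁻¹ := by
  classical
  induction hn : g.natDegree generalizing g with
  | zero =>
    refine ⟨∅, by simp, fun b hb => absurd ?_ hg⟩
    rw [eq_C_of_natDegree_eq_zero hn] at hb ⊢
    simpa using hb
  | succ n ih =>
    by_cases hroot : ∃ a, g.eval a = 0
    swap
    · exact ⟨∅, by simp, fun b hb => absurd ⟨b, hb⟩ hroot⟩
    obtain ⟨a, ha⟩ := hroot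
    obtain ⟨q, hq⟩ := exists_eq_mul_X_sub_C_add_C_eval g a
    rw [ha, C_0, add_zero] at hq
    have hq0 : q ≠ 0 := by
      rintro rfl
      exact hg (by simpa using hq)
    have hdeg : q.natDegree = n := by
      rw [hq, natDegree_mul hq0 (X_sub_C_ne_zero a), natDegree_X_sub_C] at hn
      exact Nat.succ_injective hn
    obtain ⟨S, hS, hconj⟩ := ih q hq0 hdeg
    refine ⟨insert a S, (Finset.card_insert_le a S).trans (by omega), fun b hb => ?_⟩
    by_cases hba : b = a
    · exact ⟨a, Finset.mem_insert_self a S, 1, one_ne_zero, by simp [hba]⟩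
    have hsub : b - a ≠ 0 := sub_ne_zero.mpr hba
    rw [hq, eval_mul_X_sub_C_of_ne q hba] at hb
    obtain ⟨s, hs, u, hu, h⟩ := hconj _ ((mul_eq_zero.mp hb).resolve_right hsub)
    refine ⟨s, Finset.mem_insert_of_mem hs, (b - a)⁻¹ * u, mul_ne_zero (inv_ne_zero hsub) hu, ?_⟩
    calc b = (b - a)⁻¹ * ((b - a) * b * (b - a)⁻¹) * (b - a) := by
          rw [mul_assoc (b - a), inv_mul_cancel_left₀ hsub, inv_mul_cancel_right₀ hsub]
      _ = (b - a)⁻¹ * u * s * ((b - a)⁻¹ * u)⁻¹ := by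
          rw [h, mul_inv_rev, inv_inv]
          simp only [mul_assoc]

/-- Let `D` be a division ring and `f ∈ D[x]` of degree `m ≥ 2`. Then the
fixed points of `f` lie in at most `m` conjugacy classes: there is a finite set `S ⊆ D` with
`|S| ≤ m` such that every `λ ∈ D` with `f(λ) = λ` is conjugate to some element of `S`. -/
theorem fixedPoints_in_at_most_degree_conjugacy_classes {D : Type*} [DivisionRing D]
    (f : Polynomial D) (m : ℕ) (hm : 2 ≤ m) (hdeg : f.natDegree = m) :
    ∃ S : Finset D, S.card ≤ m ∧
      ∀ lam : D, f.eval lam = lam →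
        ∃ s ∈ S, ∃ u : D, u ≠ 0 ∧ lam = u * s * u⁻¹ := by
  have hlt : (Polynomial.X : Polynomial D).natDegree < f.natDegree := by
    rw [Polynomial.natDegree_X]
    omega
  have hsub : (f - Polynomial.X).natDegree = m := by
    rw [Polynomial.natDegree_sub_eq_left_of_natDegree_lt hlt, hdeg]
  have hne : f - Polynomial.X ≠ 0 := Polynomial.ne_zero_of_natDegree_gt (n := 0) (by omega)
  obtain ⟨S, hS, hconj⟩ := exists_finset_card_le_natDegree_isRoot_conj _ hne
  refine ⟨S, hsub ▸ hS, fun lam hlam => hconj lam ?_⟩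
  rw [Polynomial.eval_sub, Polynomial.eval_X, hlam, sub_self]
end

section
/- There exist a standard polynomial $f(x) \in \mathbb{H}[x]$ over Hamilton's real quaternion algebra $\mathbb{H}$ and a point $\lambda \in \mathbb{H}$ such that $f^{\circ 2}(\lambda) = \lambda$ but $f^{\circ 4}(\lambda) \neq \lambda$. (For instance one can take $f(x) = x^2 + (i+1)x + 1 + ij$ and $\lambda = -1 + \left(\tfrac{133}{362}\sqrt{5} - \tfrac{333}{362}\right)i - \left(\tfrac{14}{181}\sqrt{5} + \tfrac{165}{181}\right)j - \left(\tfrac{26}{181}\sqrt{5} + \tfrac{22}{181}\right)ij$.) In particular, $f^{\circ r}(\lambda) = \lambda$ does not in general imply that $\lambda$ is an $r$-periodic point. -/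
open Polynomial in
/-- `ReducesTo p u v` says that `p` is congruent to `u + v x` modulo the central polynomial
`x ^ 2 + 1`. -/
def ReducesTo {D : Type*} [Ring D] (p : D[X]) (u v : D) : Prop :=
  ∃ q : D[X], p = C u + C v * X + q * (X ^ 2 + 1)

open Polynomial in
theorem X_sq_add_one_mul_comm {D : Type*} [Ring D] (p : D[X]) :
    (X ^ 2 + 1) * p = p * (X ^ 2 + 1) := by
  rw [add_mul, mul_add, X_pow_mul, one_mul, mul_one]

namespace ReducesTo

open Polynomial

variable {D : Type*} [Ring D] {p p' : D[X]} {u v u' v' : D}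

theorem X : ReducesTo (X : D[X]) 0 1 := ⟨0, by simp⟩

theorem const (a : D) : ReducesTo (C a) a 0 := ⟨0, by simp⟩

theorem add (h : ReducesTo p u v) (h' : ReducesTo p' u' v') :
    ReducesTo (p + p') (u + u') (v + v') := by
  obtain ⟨q, rfl⟩ := h
  obtain ⟨q', rfl⟩ := h'
  refine ⟨q + q', ?_⟩
  simp only [C_add, add_mul]
  abel

theorem mul (h : ReducesTo p u v) (h' : ReducesTo p' u' v') :
    ReducesTo (p * p') (u * u' - v * v') (u * v' + v * u') := by
  obtain ⟨q, rfl⟩ := h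
  obtain ⟨q', rfl⟩ := h'
  refine ⟨C (v * v') + (C u + C v * Polynomial.X) * q'
    + q * (C u' + C v' * Polynomial.X + q' * (Polynomial.X ^ 2 + 1)), ?_⟩
  have hq := X_sq_add_one_mul_comm (C u' + C v' * Polynomial.X + q' * (Polynomial.X ^ 2 + 1))
  have h₁ : (C v * Polynomial.X) * C u' = C (v * u') * Polynomial.X := by
    rw [mul_assoc, X_mul_C, ← mul_assoc, C_mul]
  have h₂ : (C v * Polynomial.X) * (C v' * Polynomial.X) = C (v * v') * Polynomial.X ^ 2 := by
    rw [← mul_assoc, mul_assoc (C v), X_mul_C, ← mul_assoc, mul_assoc, C_mul, sq]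
  have h₃ : (C u + C v * Polynomial.X) * (C u' + C v' * Polynomial.X) =
      C (u * u' - v * v') + C (u * v' + v * u') * Polynomial.X
        + C (v * v') * (Polynomial.X ^ 2 + 1) := by
    rw [add_mul, mul_add, mul_add, h₁, h₂]
    simp only [C_sub, C_add, C_mul, add_mul, mul_add, mul_one, mul_assoc]
    abel
  rw [add_mul _ (q * _), mul_assoc q (_ ^ 2 + 1), hq, mul_add (C u + C v * Polynomial.X), h₃]
  simp only [add_mul, mul_assoc]
  abel

theorem quadratic_comp (h : ReducesTo p u v) (a b c : D) :
    ReducesTo ((C a * Polynomial.X ^ 2 + C b * Polynomial.X + C c).comp p)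
      (a * (u * u - v * v) + b * u + c) (a * (u * v + v * u) + b * v) := by
  have key := (((const a).mul (h.mul h)).add ((const b).mul h)).add (const c)
  have hp : (C a * Polynomial.X ^ 2 + C b * Polynomial.X + C c).comp p =
      C a * (p * p) + C b * p + C c := by
    simp [sq]
  rw [hp]
  simpa using key

theorem eval_eq (h : ReducesTo p u v) {x : D} (hx : x * x = -1) :
    p.eval x = u + v * x := by
  obtain ⟨q, rfl⟩ := h
  have hq : (q * (Polynomial.X ^ 2 + 1)).eval x = 0 := by
    rw [mul_add, mul_one, sq, ← mul_assoc, eval_add, eval_mul_X, eval_mul_X, mul_assoc, hx]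
    simp
  rw [eval_add, hq]
  simp

end ReducesTo

/-- There exist a standard polynomial `f ∈ ℍ[x]` over Hamilton's real
quaternions and a point `λ ∈ ℍ` with `f^{∘2}(λ) = λ` but `f^{∘4}(λ) ≠ λ`. In particular,
`f^{∘r}(λ) = λ` does not in general imply that `λ` is an `r`-periodic point. -/
theorem exists_quaternion_poly_two_cycle_not_periodic :
    ∃ (f : Polynomial (Quaternion ℝ)) (lam : Quaternion ℝ),
      (ocomp f 2).eval lam = lam ∧ (ocomp f 4).eval lam ≠ lam := by
  obtain ⟨i, hi⟩ : ∃ q : Quaternion ℝ, q.re = 0 ∧ q.imI = 1 ∧ q.imJ = 0 ∧ q.imK = 0 :=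
    ⟨⟨0, 1, 0, 0⟩, rfl, rfl, rfl, rfl⟩
  obtain ⟨j, hj⟩ : ∃ q : Quaternion ℝ, q.re = 0 ∧ q.imI = 0 ∧ q.imJ = 1 ∧ q.imK = 0 :=
    ⟨⟨0, 0, 1, 0⟩, rfl, rfl, rfl, rfl⟩
  have hii : i * i = -1 := by
    apply Quaternion.ext <;>
      simp [hi, Quaternion.re_one,
      Quaternion.imI_one, Quaternion.imJ_one, Quaternion.imK_one]
  have hjj : j * j = -1 := by
    apply Quaternion.ext <;>
      simp [hj, Quaternion.re_one,
      Quaternion.imI_one, Quaternion.imJ_one, Quaternion.imK_one]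
  let f : Polynomial (Quaternion ℝ) := .C i * .X ^ 2 + .C j * .X + .C i
  have h₂ : ReducesTo (ocomp f 2) (i + i) (-1) := by
    have h : ReducesTo (ocomp f 2) _ _ :=
      (ReducesTo.X.quadratic_comp i j i).quadratic_comp i j i
    have hu : i * (0 * 0 - 1 * 1) + j * 0 + i = 0 := by simp
    have hv : i * (0 * 1 + 1 * 0) + j * 1 = j := by simp
    rw [hu, hv, hjj] at h
    simpa using h
  have h₄ := (h₂.quadratic_comp i j i).quadratic_comp i j i
  refine ⟨f, i, ?_, fun h => ?_⟩
  · rw [h₂.eval_eq hii]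
    simp
  · have h' := congrArg QuaternionAlgebra.imI ((h₄.eval_eq hii).symm.trans h)
    simp [hi, hj, Quaternion.re_one,
      Quaternion.imI_one, Quaternion.imJ_one, Quaternion.imK_one] at h'
    norm_num at h'
end
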